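/- Fix λ > 0. For t > 0 let v = v(t) > 0 be determined by t² = v² / ∫₀^v s/(e^s − 1) ds, let g(t) = 2v/t − t·log(1 − e^{−v}), define ψ(t) = g(t)/t − λ/t², and set t₀ = λ / (∫₀^λ s/(e^s − 1) ds)^{1/2}. Then ψ″(t₀) = −2λ(e^λ − 1) / (t₀⁴·(e^λ − 1 − t₀²/2)) < 0. -/

import Mathlib

open Real Set Filter Topology MeasureTheory

lemma measurable_div_exp_sub_one : Measurable fun s : ℝ => s / (exp s - 1) := by
  fun_prop

lemma intervalIntegrable_div_exp_sub_one {w : ℝ} (hw : 0 ≤ w) :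
    IntervalIntegrable (fun s : ℝ => s / (exp s - 1)) volume 0 w := by
  rw [intervalIntegrable_iff_integrableOn_Ioc_of_le hw]
  refine Measure.integrableOn_of_bounded (M := 1) (by simp)
    measurable_div_exp_sub_one.aestronglyMeasurable ?_
  refine (ae_restrict_mem measurableSet_Ioc).mono fun s hs => ?_
  have h1 : s + 1 ≤ exp s := add_one_le_exp s
  have hs0 : 0 < s := hs.1
  rw [Real.norm_of_nonneg (div_nonneg hs0.le (by linarith)), div_le_one (by linarith)]
  linarith

/-- Since `exp s < exp w` for `s < w`, the integrand exceeds `s / (exp w - 1)`. -/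
lemma sq_div_lt_integral_div_exp_sub_one {w : ℝ} (hw : 0 < w) :
    w ^ 2 / (2 * (exp w - 1)) < ∫ s in (0 : ℝ)..w, s / (exp s - 1) := by
  have hlin : IntervalIntegrable (fun s : ℝ => s / (exp w - 1)) volume 0 w :=
    (by fun_prop : Continuous fun s : ℝ => s / (exp w - 1)).intervalIntegrable _ _
  have hpos : 0 < ∫ s in (0 : ℝ)..w, (s / (exp s - 1) - s / (exp w - 1)) := by
    refine intervalIntegral.intervalIntegral_pos_of_pos_on
      ((intervalIntegrable_div_exp_sub_one hw.le).sub hlin) (fun s hs => ?_) hw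
    have h1 : 1 < exp s := one_lt_exp_iff.2 hs.1
    have h2 : exp s < exp w := exp_lt_exp.2 hs.2
    exact sub_pos.2 (div_lt_div_of_pos_left hs.1 (by linarith) (by linarith))
  rw [intervalIntegral.integral_sub (intervalIntegrable_div_exp_sub_one hw.le) hlin,
    intervalIntegral.integral_div, integral_id] at hpos
  have h3 : (w ^ 2 - 0 ^ 2) / 2 / (exp w - 1) = w ^ 2 / (2 * (exp w - 1)) := by
    rw [div_div]; simp
  linarith

lemma integral_div_exp_sub_one_pos {w : ℝ} (hw : 0 < w) :
    0 < ∫ s in (0 : ℝ)..w, s / (exp s - 1) := by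
  have h1 : 1 < exp w := one_lt_exp_iff.2 hw
  have h2 : 0 < exp w - 1 := by linarith
  exact lt_trans (by positivity) (sq_div_lt_integral_div_exp_sub_one hw)

lemma exp_sub_one_sub_half_sq_pos {w t : ℝ} (hw : 0 < w)
    (ht : t ^ 2 = w ^ 2 / ∫ s in (0 : ℝ)..w, s / (exp s - 1)) :
    0 < exp w - 1 - t ^ 2 / 2 := by
  have h1 : 1 < exp w := one_lt_exp_iff.2 hw
  have h2 := sq_div_lt_integral_div_exp_sub_one hw
  have h3 := integral_div_exp_sub_one_pos hw
  rw [div_lt_iff₀ (by linarith)] at h2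
  rw [ht, sub_pos, div_div, div_lt_iff₀ (by positivity)]
  linarith

lemma hasDerivAt_integral_div_exp_sub_one {w : ℝ} (hw : 0 < w) :
    HasDerivAt (fun u : ℝ => ∫ s in (0 : ℝ)..u, s / (exp s - 1)) (w / (exp w - 1)) w := by
  have h1 : 1 < exp w := one_lt_exp_iff.2 hw
  refine intervalIntegral.integral_hasDerivAt_right
    (intervalIntegrable_div_exp_sub_one hw.le)
    measurable_div_exp_sub_one.stronglyMeasurable.stronglyMeasurableAtFilter ?_
  exact continuousAt_id.div (by fun_prop) (by simp only [ne_eq]; linarith)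

/-- The inverse of `v`, as a function of the value `w = v t`. -/
noncomputable def szekeresParam (w : ℝ) : ℝ := w / √(∫ s in (0 : ℝ)..w, s / (exp s - 1))

lemma szekeresParam_pos {w : ℝ} (hw : 0 < w) : 0 < szekeresParam w :=
  div_pos hw (sqrt_pos.2 (integral_div_exp_sub_one_pos hw))

lemma szekeresParam_sq {w : ℝ} (hw : 0 < w) :
    szekeresParam w ^ 2 = w ^ 2 / ∫ s in (0 : ℝ)..w, s / (exp s - 1) := by
  rw [szekeresParam, div_pow, sq_sqrt (integral_div_exp_sub_one_pos hw).le]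

lemma eq_szekeresParam {w t : ℝ} (ht : 0 < t) (hw : 0 < w)
    (h : t ^ 2 = w ^ 2 / ∫ s in (0 : ℝ)..w, s / (exp s - 1)) : szekeresParam w = t := by
  rw [← szekeresParam_sq hw] at h
  exact ((pow_left_inj₀ ht.le (szekeresParam_pos hw).le two_ne_zero).1 h).symm

lemma hasDerivAt_szekeresParam {w : ℝ} (hw : 0 < w) :
    HasDerivAt szekeresParam
      (szekeresParam w * (exp w - 1 - szekeresParam w ^ 2 / 2) / (w * (exp w - 1))) w := by
  have h1 : 1 < exp w := one_lt_exp_iff.2 hw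
  have h1' : exp w - 1 ≠ 0 := by linarith
  have hH := integral_div_exp_sub_one_pos hw
  have hd := (hasDerivAt_id w).div
    ((hasDerivAt_integral_div_exp_sub_one hw).sqrt hH.ne') (sqrt_pos.2 hH).ne'
  refine hd.congr_deriv ?_
  have hr := sqrt_pos.2 hH
  simp only [szekeresParam, id]
  set r := √(∫ s in (0 : ℝ)..w, s / (exp s - 1))
  field_simp

lemma szekeresParam_deriv_pos {w : ℝ} (hw : 0 < w) :
    0 < szekeresParam w * (exp w - 1 - szekeresParam w ^ 2 / 2) / (w * (exp w - 1)) := by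
  have h1 : 1 < exp w := one_lt_exp_iff.2 hw
  exact div_pos (mul_pos (szekeresParam_pos hw)
    (exp_sub_one_sub_half_sq_pos hw (szekeresParam_sq hw))) (mul_pos hw (by linarith))

lemma strictMonoOn_szekeresParam : StrictMonoOn szekeresParam (Ioi 0) := by
  refine strictMonoOn_of_deriv_pos (convex_Ioi 0)
    (fun w hw => (hasDerivAt_szekeresParam hw).continuousAt.continuousWithinAt) fun w hw => ?_
  rw [interior_Ioi] at hw
  rw [(hasDerivAt_szekeresParam hw).deriv]
  exact szekeresParam_deriv_pos hw

section Inverse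

variable {v : ℝ → ℝ} (hv : ∀ t : ℝ, 0 < t → 0 < v t ∧ szekeresParam (v t) = t)
include hv

lemma rightInverse_szekeresParam {w : ℝ} (hw : 0 < w) : v (szekeresParam w) = w := by
  have h := hv _ (szekeresParam_pos hw)
  exact strictMonoOn_szekeresParam.injOn h.1 hw h.2

lemma continuousAt_of_szekeresParam_leftInverse {t : ℝ} (ht : 0 < t) : ContinuousAt v t := by
  have hmono : StrictMonoOn v (Ioi 0) := fun a ha b hb hab => by
    rw [← strictMonoOn_szekeresParam.lt_iff_lt (hv a ha).1 (hv b hb).1, (hv a ha).2, (hv b hb).2]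
    exact hab
  refine hmono.continuousAt_of_image_mem_nhds (Ioi_mem_nhds ht) ?_
  exact mem_of_superset (Ioi_mem_nhds (hv t ht).1) fun w hw =>
    ⟨szekeresParam w, szekeresParam_pos hw, rightInverse_szekeresParam hv hw⟩

lemma hasDerivAt_of_szekeresParam_leftInverse {t : ℝ} (ht : 0 < t) :
    HasDerivAt v (v t * (exp (v t) - 1) / (t * (exp (v t) - 1 - t ^ 2 / 2))) t := by
  have hvt := (hv t ht).1
  have h := (hasDerivAt_szekeresParam hvt).of_local_left_inverse
    (continuousAt_of_szekeresParam_leftInverse hv ht) (szekeresParam_deriv_pos hvt).ne'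
    ((eventually_gt_nhds ht).mono fun s hs => (hv s hs).2)
  rwa [(hv t ht).2, inv_div] at h

lemma hasDerivAt_szekeres_exponent (lam : ℝ) {t : ℝ} (ht : 0 < t) :
    HasDerivAt (fun t => (2 * v t / t - t * log (1 - exp (-(v t)))) / t - lam / t ^ 2)
      (2 * (lam - v t) / t ^ 3) t := by
  have hvt := (hv t ht).1
  have hd := hasDerivAt_of_szekeresParam_leftInverse hv ht
  have hD : 0 < exp (v t) - 1 - t ^ 2 / 2 := by
    have := exp_sub_one_sub_half_sq_pos hvt (szekeresParam_sq hvt)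
    rwa [(hv t ht).2] at this
  have h1 : 1 < exp (v t) := one_lt_exp_iff.2 hvt
  have h2 : 0 < exp (v t) - 1 := by linarith
  have hexp : exp (-(v t)) = 1 / exp (v t) := by rw [exp_neg, one_div]
  have hL : 1 - exp (-(v t)) ≠ 0 := by
    have : exp (-(v t)) < 1 := exp_lt_one_iff.2 (by linarith)
    linarith
  have hlog := ((hd.neg.exp.const_sub 1).log hL)
  have key := (((hd.const_mul 2).div (hasDerivAt_id t) ht.ne').sub
    ((hasDerivAt_id t).mul hlog)).div (hasDerivAt_id t) ht.ne' |>.sub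
    ((hasDerivAt_const t lam).div (hasDerivAt_pow 2 t) (by positivity))
  refine key.congr_deriv ?_
  have hE : 1 - exp (-(v t)) = (exp (v t) - 1) / exp (v t) := by
    rw [hexp]; field_simp
  simp only [id, Pi.sub_apply, Pi.mul_apply, Pi.div_apply, Pi.neg_apply]
  generalize log (1 - exp (-(v t))) = L
  rw [hE, hexp]
  have hE0 : exp (v t) ≠ 0 := (exp_pos _).ne'
  obtain ⟨D, hDeq⟩ : ∃ D, D = exp (v t) - 1 - t ^ 2 / 2 := ⟨_, rfl⟩
  rw [← hDeq] at hD ⊢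
  obtain ⟨M, hM⟩ : ∃ M, M = exp (v t) - 1 := ⟨_, rfl⟩
  rw [← hM] at hDeq h2 ⊢
  have : t ^ 2 = 2 * (M - D) := by linarith
  push_cast
  field_simp
  rw [this]
  ring

end Inverse


/-- For `λ > 0`, with `v(t)` determined by `t² = v² / ∫₀^v s/(eˢ-1) ds`,
`g(t) = 2v/t - t log(1 - e^{-v})`, `ψ(t) = g(t)/t - λ/t²` and
`t₀ = λ/(∫₀^λ s/(eˢ-1) ds)^{1/2}`, one has
`ψ″(t₀) = -2λ(e^λ - 1)/(t₀⁴ (e^λ - 1 - t₀²/2)) < 0`. -/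
theorem stmt_10 (lam : ℝ) (hlam : 0 < lam) (v g ψ : ℝ → ℝ)
    (hv : ∀ t : ℝ, 0 < t → 0 < v t ∧
      t ^ 2 = (v t) ^ 2 / ∫ s in (0 : ℝ)..(v t), s / (Real.exp s - 1))
    (hg : ∀ t : ℝ, 0 < t →
      g t = 2 * v t / t - t * Real.log (1 - Real.exp (-(v t))))
    (hψ : ∀ t : ℝ, 0 < t → ψ t = g t / t - lam / t ^ 2)
    (t₀ : ℝ)
    (ht₀ : t₀ = lam / Real.sqrt (∫ s in (0 : ℝ)..lam, s / (Real.exp s - 1))) :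
    deriv (deriv ψ) t₀ =
      -2 * lam * (Real.exp lam - 1) / (t₀ ^ 4 * (Real.exp lam - 1 - t₀ ^ 2 / 2)) ∧
    deriv (deriv ψ) t₀ < 0 := by
  have hv' : ∀ t : ℝ, 0 < t → 0 < v t ∧ szekeresParam (v t) = t := fun t ht =>
    ⟨(hv t ht).1, eq_szekeresParam ht (hv t ht).1 (hv t ht).2⟩
  have ht : t₀ = szekeresParam lam := ht₀
  have ht₀pos : 0 < t₀ := ht ▸ szekeresParam_pos hlam
  have hvt₀ : v t₀ = lam := by rw [ht, rightInverse_szekeresParam hv' hlam]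
  have hψ' : ∀ t : ℝ, 0 < t → deriv ψ t = 2 * (lam - v t) / t ^ 3 := fun t htpos => by
    refine ((hasDerivAt_szekeres_exponent hv' lam htpos).congr_of_eventuallyEq ?_).deriv
    filter_upwards [eventually_gt_nhds htpos] with s hs
    rw [hψ s hs, hg s hs]
  have hD : 0 < exp lam - 1 - t₀ ^ 2 / 2 :=
    exp_sub_one_sub_half_sq_pos hlam (ht ▸ szekeresParam_sq hlam)
  have hE : 0 < exp lam - 1 := sub_pos.2 (one_lt_exp_iff.2 hlam)
  have hd := hasDerivAt_of_szekeresParam_leftInverse hv' ht₀pos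
  rw [hvt₀] at hd
  have hval : deriv (deriv ψ) t₀ =
      -2 * lam * (exp lam - 1) / (t₀ ^ 4 * (exp lam - 1 - t₀ ^ 2 / 2)) := by
    have h2 := ((hd.const_sub lam).const_mul 2).div (hasDerivAt_pow 3 t₀) (by positivity)
    have h3 : deriv ψ =ᶠ[𝓝 t₀] fun t => 2 * (lam - v t) / t ^ 3 :=
      (eventually_gt_nhds ht₀pos).mono hψ'
    rw [(h2.congr_of_eventuallyEq h3).deriv, hvt₀]
    generalize exp lam - 1 - t₀ ^ 2 / 2 = D at hD ⊢
    field_simp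
    ring
  refine ⟨hval, ?_⟩
  rw [hval]
  exact div_neg_of_neg_of_pos (by nlinarith [mul_pos hlam hE]) (by positivity)
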